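/- arXiv:2001.02229 — 4 statements merged into one kernel-verified Lean document; each statement's English description precedes it below -/
import Mathlib

section
/- Fix σ_ε ≥ 0, σ_0 ≥ 0, ρ_1 ∈ [0,1], ρ_2 ∈ [0,1), q_1, q_2 ∈ ℝ and c > 0. Set m(τ) = σ_ε q_1 + q_2√(σ_0² + τ²), v(τ) = σ_ε²(1−ρ_1) + (σ_0² + τ²)(1−ρ_2), μ_0 = σ_ε q_1 + σ_0 q_2, and define the type II error of the test with acceptance region |x| ≤ μ_0 + c as T_1(τ) = Φ((μ_0 + c − m(τ))/√v(τ)) − Φ((−μ_0 − c − m(τ))/√v(τ)). Then lim_{τ→∞} τ·T_1(τ) = (2(c + μ_0)/√(1−ρ_2))·φ(q_2/√(1−ρ_2)). -/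
open MeasureTheory ProbabilityTheory Filter

/-- The standard normal cumulative distribution function `Φ`. -/
noncomputable def stdGaussCDF (x : ℝ) : ℝ :=
  ((gaussianReal 0 1) (Set.Iic x)).toReal

/-- The standard normal density `φ(x) = (2π)^{-1/2} e^{-x²/2}`. -/
noncomputable def stdGaussPDF (x : ℝ) : ℝ :=
  (Real.sqrt (2 * Real.pi))⁻¹ * Real.exp (-x ^ 2 / 2)

theorem stdGaussPDF_eq_gaussianPDFReal : stdGaussPDF = gaussianPDFReal 0 1 := by
  funext x
  simp [stdGaussPDF, gaussianPDFReal]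

theorem continuous_stdGaussPDF : Continuous stdGaussPDF := by
  unfold stdGaussPDF
  fun_prop

theorem stdGaussPDF_neg (x : ℝ) : stdGaussPDF (-x) = stdGaussPDF x := by
  simp [stdGaussPDF]

theorem integrable_stdGaussPDF : Integrable stdGaussPDF := by
  rw [stdGaussPDF_eq_gaussianPDFReal]
  exact integrable_gaussianPDFReal 0 1

theorem stdGaussCDF_eq_integral (x : ℝ) :
    stdGaussCDF x = ∫ t in Set.Iic x, stdGaussPDF t := by
  rw [stdGaussCDF, gaussianReal_apply_eq_integral _ one_ne_zero, stdGaussPDF_eq_gaussianPDFReal,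
    ENNReal.toReal_ofReal]
  exact integral_nonneg fun t => gaussianPDFReal_nonneg 0 1 t

theorem hasStrictDerivAt_stdGaussCDF (x : ℝ) :
    HasStrictDerivAt stdGaussCDF (stdGaussPDF x) x := by
  have h : stdGaussCDF = fun y => stdGaussCDF 0 + ∫ t in (0 : ℝ)..y, stdGaussPDF t := by
    funext y
    rw [← intervalIntegral.integral_Iic_sub_Iic integrable_stdGaussPDF.integrableOn
      integrable_stdGaussPDF.integrableOn, ← stdGaussCDF_eq_integral, ← stdGaussCDF_eq_integral]
    ring
  rw [h]
  exact (continuous_stdGaussPDF.integral_hasStrictDerivAt 0 x).const_add _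

/-- If `f` is strictly differentiable at `x`, `a` and `b` tend to `x` and the rescaled increments
`r * (a - b)` converge, then so do the rescaled increments `r * (f a - f b)`. -/
theorem HasStrictDerivAt.tendsto_mul_sub {α : Type*} {l : Filter α} {f : ℝ → ℝ} {f' x L : ℝ}
    (hf : HasStrictDerivAt f f' x) {r a b : α → ℝ} (ha : Tendsto a l (nhds x))
    (hb : Tendsto b l (nhds x)) (hr : Tendsto (fun t => r t * (a t - b t)) l (nhds L)) :
    Tendsto (fun t => r t * (f (a t) - f (b t))) l (nhds (L * f')) := by
  have ho := hf.isLittleO.comp_tendsto (ha.prodMk_nhds hb)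
  have h0 : Tendsto (fun t => r t * (f (a t) - f (b t) - (a t - b t) * f')) l (nhds 0) := by
    refine (Asymptotics.isLittleO_one_iff ℝ).1
      (((Asymptotics.isBigO_refl r l).mul_isLittleO ?_).trans_isBigO (hr.isBigO_one ℝ))
    simpa [Function.comp_def] using ho
  convert h0.add (hr.mul_const f') using 2 <;> ring

/-- Leading-order term of the type II error of the paper's fixed-cutoff test: with
`m(τ) = σ_ε q₁ + q₂√(σ₀²+τ²)`, `v(τ) = σ_ε²(1-ρ₁) + (σ₀²+τ²)(1-ρ₂)`,
`μ₀ = σ_ε q₁ + σ₀ q₂`, and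
`T₁(τ) = Φ((μ₀+c-m(τ))/√v(τ)) - Φ((-μ₀-c-m(τ))/√v(τ))`,
one has `τ·T₁(τ) → (2(c+μ₀)/√(1-ρ₂))·φ(q₂/√(1-ρ₂))` as `τ → ∞`. -/
theorem typeII_leading_term (σε σ₀ ρ₁ ρ₂ : ℝ) (hσε : 0 ≤ σε) (hσ₀ : 0 ≤ σ₀)
    (hρ₁ : ρ₁ ∈ Set.Icc (0 : ℝ) 1) (hρ₂ : ρ₂ ∈ Set.Ico (0 : ℝ) 1)
    (q₁ q₂ : ℝ) (c : ℝ) (hc : 0 < c)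
    (m v : ℝ → ℝ) (μ₀ : ℝ) (T₁ : ℝ → ℝ)
    (hm : ∀ τ, m τ = σε * q₁ + q₂ * Real.sqrt (σ₀ ^ 2 + τ ^ 2))
    (hv : ∀ τ, v τ = σε ^ 2 * (1 - ρ₁) + (σ₀ ^ 2 + τ ^ 2) * (1 - ρ₂))
    (hμ₀ : μ₀ = σε * q₁ + σ₀ * q₂)
    (hT₁ : ∀ τ, T₁ τ =
      stdGaussCDF ((μ₀ + c - m τ) / Real.sqrt (v τ)) -
        stdGaussCDF ((-μ₀ - c - m τ) / Real.sqrt (v τ))) :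
    Tendsto (fun τ => τ * T₁ τ) atTop
      (nhds ((2 * (c + μ₀) / Real.sqrt (1 - ρ₂)) *
        stdGaussPDF (q₂ / Real.sqrt (1 - ρ₂)))) := by
  obtain ⟨-, hρ⟩ := hρ₂
  have hk : 0 < 1 - ρ₂ := sub_pos.2 hρ
  set D : ℝ → ℝ := fun s =>
    Real.sqrt (σε ^ 2 * (1 - ρ₁) * s ^ 2 + (σ₀ ^ 2 * s ^ 2 + 1) * (1 - ρ₂)) with hD
  have hDc : Continuous D := by fun_prop
  have hD0 : D 0 = Real.sqrt (1 - ρ₂) := by simp [hD]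
  have hDne : D 0 ≠ 0 := hD0 ▸ (Real.sqrt_pos.2 hk).ne'
  have hsqrt : ∀ τ : ℝ, 0 < τ →
      Real.sqrt (σ₀ ^ 2 + τ ^ 2) = τ * Real.sqrt (σ₀ ^ 2 * τ⁻¹ ^ 2 + 1) := by
    intro τ hτ
    rw [← Real.sqrt_sq hτ.le, ← Real.sqrt_mul (sq_nonneg _), Real.sqrt_sq hτ.le]
    congr 1
    field_simp
  have hsv : ∀ τ : ℝ, 0 < τ → Real.sqrt (v τ) = τ * D τ⁻¹ := by
    intro τ hτ
    rw [hv, hD, ← Real.sqrt_sq hτ.le, ← Real.sqrt_mul (sq_nonneg _), Real.sqrt_sq hτ.le]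
    congr 1
    field_simp
  have hlim : ∀ k : ℝ, Tendsto (fun τ => (k - m τ) / Real.sqrt (v τ)) atTop
      (nhds (-(q₂ / Real.sqrt (1 - ρ₂)))) := by
    intro k
    have hcont : ContinuousAt (fun s : ℝ =>
        ((k - σε * q₁) * s - q₂ * Real.sqrt (σ₀ ^ 2 * s ^ 2 + 1)) / D s) 0 :=
      ContinuousAt.div (by fun_prop) hDc.continuousAt hDne
    have ht := hcont.tendsto.comp tendsto_inv_atTop_zero
    have hval : ((k - σε * q₁) * 0 - q₂ * Real.sqrt (σ₀ ^ 2 * 0 ^ 2 + 1)) / D 0 =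
        -(q₂ / Real.sqrt (1 - ρ₂)) := by
      simp [hD0, neg_div]
    rw [hval] at ht
    refine ht.congr' ?_
    filter_upwards [eventually_gt_atTop 0] with τ hτ
    rw [hsv τ hτ, hm, hsqrt τ hτ, Function.comp_apply, ← mul_div_mul_left _ _ hτ.ne']
    congr 1
    field_simp
    ring
  have hr : Tendsto (fun τ => τ * ((μ₀ + c - m τ) / Real.sqrt (v τ) -
      (-μ₀ - c - m τ) / Real.sqrt (v τ))) atTop
      (nhds (2 * (c + μ₀) / Real.sqrt (1 - ρ₂))) := by
    have hcont : ContinuousAt (fun s : ℝ => 2 * (c + μ₀) / D s) 0 :=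
      continuousAt_const.div hDc.continuousAt hDne
    have ht := hcont.tendsto.comp tendsto_inv_atTop_zero
    rw [hD0] at ht
    refine ht.congr' ?_
    filter_upwards [eventually_gt_atTop 0] with τ hτ
    rw [hsv τ hτ, Function.comp_apply, ← sub_div, ← mul_div_assoc, mul_div_mul_left _ _ hτ.ne']
    ring
  simp only [hT₁]
  rw [← stdGaussPDF_neg (q₂ / Real.sqrt (1 - ρ₂))]
  exact (hasStrictDerivAt_stdGaussCDF _).tendsto_mul_sub (hlim _) (hlim _) hr
end

section
/- Fix μ_0 ∈ ℝ and Φ_0 > 0. For α ∈ (0,1) let t(α) be the unique solution of α = 2 − Φ(t) − Φ(t + 2μ_0/√Φ_0), and let z(α) be the unique solution of α = 2 − 2Φ(z) (i.e. z(α) = z_{α/2}, the upper α/2-quantile of the standard normal distribution). Then t(α) → ∞ and z(α) → ∞ as α → 0⁺, and lim_{α→0⁺} t(α)/z(α) = 1. -/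
open MeasureTheory ProbabilityTheory Filter

/-- The standard normal cumulative distribution function is strictly increasing. -/
lemma strictMono_stdGaussCDF : StrictMono stdGaussCDF := by
  intro x y hxy
  have : (gaussianReal 0 1).IsOpenPosMeasure :=
    (gaussianReal_absolutelyContinuous' 0 one_ne_zero).isOpenPosMeasure
  have hpos : 0 < (gaussianReal 0 1).real (Set.Ioc x y) := by
    rw [measureReal_def, ENNReal.toReal_pos_iff]
    refine ⟨lt_of_lt_of_le (isOpen_Ioo.measure_pos _ (Set.nonempty_Ioo.2 hxy))
      (measure_mono Set.Ioo_subset_Ioc_self), measure_lt_top _ _⟩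
  have hadd : (gaussianReal 0 1).real (Set.Iic y) =
      (gaussianReal 0 1).real (Set.Iic x) + (gaussianReal 0 1).real (Set.Ioc x y) := by
    rw [← Set.Iic_union_Ioc_eq_Iic hxy.le]
    exact measureReal_union (Set.Iic_disjoint_Ioc le_rfl) measurableSet_Ioc
  change (gaussianReal 0 1).real (Set.Iic x) < (gaussianReal 0 1).real (Set.Iic y)
  linarith

lemma stdGaussCDF_lt_one (x : ℝ) : stdGaussCDF x < 1 :=
  (strictMono_stdGaussCDF (lt_add_one x)).trans_le measureReal_le_one

/-- If `g y` is the average of `g x` and `g (x + c)`, then `x` and `y` are within `|c|`. -/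
lemma abs_sub_le_of_add_eq_two_mul {g : ℝ → ℝ} (hg : StrictMono g) {x y c : ℝ}
    (h : g x + g (x + c) = 2 * g y) : |x - y| ≤ |c| := by
  have hc := le_abs_self c
  have hc' := neg_abs_le c
  rw [abs_le]
  constructor
  · by_contra! hlt
    have h₁ : g x < g y := hg (by linarith [abs_nonneg c])
    have h₂ : g (x + c) < g y := hg (by linarith)
    linarith
  · by_contra! hlt
    have h₁ : g y < g x := hg (by linarith [abs_nonneg c])
    have h₂ : g y < g (x + c) := hg (by linarith)
    linarith

/-- Note 2 in the proof of Result 2: if for every `α ∈ (0,1)` the cutoff `t α` solves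
`α = 2 - Φ(t) - Φ(t + 2μ₀/√Φ₀)` and `z α` solves `α = 2 - 2Φ(z)` (so `z α = z_{α/2}`),
then `t α → ∞` and `z α → ∞` as `α → 0⁺`, and `t α / z α → 1`. -/
theorem cutoff_asymptotics (μ₀ Φ₀ : ℝ) (hΦ₀ : 0 < Φ₀) (t z : ℝ → ℝ)
    (ht : ∀ α ∈ Set.Ioo (0 : ℝ) 1,
      α = 2 - stdGaussCDF (t α) - stdGaussCDF (t α + 2 * μ₀ / Real.sqrt Φ₀))
    (hz : ∀ α ∈ Set.Ioo (0 : ℝ) 1, α = 2 - 2 * stdGaussCDF (z α)) :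
    Tendsto t (nhdsWithin 0 (Set.Ioi 0)) atTop ∧
      Tendsto z (nhdsWithin 0 (Set.Ioi 0)) atTop ∧
      Tendsto (fun α => t α / z α) (nhdsWithin 0 (Set.Ioi 0)) (nhds 1) := by
  have hmem : ∀ᶠ α in nhdsWithin (0 : ℝ) (Set.Ioi 0), α ∈ Set.Ioo (0 : ℝ) 1 :=
    Ioo_mem_nhdsGT one_pos
  have hdist : ∀ᶠ α in nhdsWithin (0 : ℝ) (Set.Ioi 0),
      |t α - z α| ≤ |2 * μ₀ / Real.sqrt Φ₀| := by
    filter_upwards [hmem] with α hα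
    exact abs_sub_le_of_add_eq_two_mul strictMono_stdGaussCDF (by linarith [ht α hα, hz α hα])
  have hz_top : Tendsto z (nhdsWithin 0 (Set.Ioi 0)) atTop := by
    refine tendsto_atTop.2 fun K => ?_
    have hK : 0 < 2 - 2 * stdGaussCDF K := by linarith [stdGaussCDF_lt_one K]
    filter_upwards [hmem, Ioo_mem_nhdsGT hK] with α hα hαK
    exact (strictMono_stdGaussCDF.lt_iff_lt.1 (by linarith [hz α hα, hαK.2])).le
  refine ⟨?_, hz_top, ?_⟩
  · refine tendsto_atTop_mono' _ ?_
      (tendsto_atTop_add_const_right _ (-|2 * μ₀ / Real.sqrt Φ₀|) hz_top)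
    filter_upwards [hdist] with α hα
    linarith [(abs_le.1 hα).1]
  · rw [tendsto_iff_norm_sub_tendsto_zero]
    refine squeeze_zero' (Eventually.of_forall fun _ => norm_nonneg _) ?_
      (hz_top.const_div_atTop |2 * μ₀ / Real.sqrt Φ₀|)
    filter_upwards [hdist, hz_top.eventually_gt_atTop 0] with α hα hpos
    rw [div_sub_one hpos.ne', Real.norm_eq_abs, abs_div, abs_of_pos hpos]
    gcongr
end

section
/- Fix σ_ε ≥ 0, σ_0 ≥ 0, ρ_1 ∈ [0,1], ρ_2 ∈ [0,1), q_1, q_2 ∈ ℝ, with Φ_0 = σ_ε²(1−ρ_1) + σ_0²(1−ρ_2) > 0, μ_0 = σ_ε q_1 + σ_0 q_2, and z > 0. For τ > 0 define μ_1(τ) = σ_ε q_1/τ + q_2√(σ_0²/τ² + 1), Φ_1(τ) = σ_ε²(1−ρ_1)/τ² + (σ_0²/τ² + 1)(1−ρ_2), and A(τ)² = (τ²/(2Φ_0) − 1/(2Φ_1(τ)))·(z² − μ_0²/Φ_0)/2 + (μ_0τ/(2Φ_0) − μ_1(τ)/(2Φ_1(τ)))². Then lim_{τ→∞} √(max(A(τ)²,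 0))/τ = z/(2√Φ_0). -/
open Filter

/-- Asymptotics of `A^α(τ)` in the proof of part 2 of Result 2: with
`μ₁(τ) = σ_ε q₁/τ + q₂√(σ₀²/τ²+1)`, `Φ₁(τ) = σ_ε²(1-ρ₁)/τ² + (σ₀²/τ²+1)(1-ρ₂)`,
`Φ₀ = σ_ε²(1-ρ₁) + σ₀²(1-ρ₂) > 0`, `μ₀ = σ_ε q₁ + σ₀ q₂`, and
`A(τ)² = (τ²/(2Φ₀) - 1/(2Φ₁(τ)))·(z² - μ₀²/Φ₀)/2 + (μ₀τ/(2Φ₀) - μ₁(τ)/(2Φ₁(τ)))²`,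
one has `√(max(A(τ)², 0))/τ → z/(2√Φ₀)` as `τ → ∞`. -/
theorem A_alpha_asymptotics (σε σ₀ ρ₁ ρ₂ : ℝ) (hσε : 0 ≤ σε) (hσ₀ : 0 ≤ σ₀)
    (hρ₁ : ρ₁ ∈ Set.Icc (0 : ℝ) 1) (hρ₂ : ρ₂ ∈ Set.Ico (0 : ℝ) 1)
    (q₁ q₂ : ℝ) (Φ₀ μ₀ : ℝ)
    (hΦ₀def : Φ₀ = σε ^ 2 * (1 - ρ₁) + σ₀ ^ 2 * (1 - ρ₂)) (hΦ₀ : 0 < Φ₀)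
    (hμ₀ : μ₀ = σε * q₁ + σ₀ * q₂) (z : ℝ) (hz : 0 < z)
    (μ₁ Φ₁ A2 : ℝ → ℝ)
    (hμ₁ : ∀ τ, μ₁ τ = σε * q₁ / τ + q₂ * Real.sqrt (σ₀ ^ 2 / τ ^ 2 + 1))
    (hΦ₁ : ∀ τ, Φ₁ τ = σε ^ 2 * (1 - ρ₁) / τ ^ 2 + (σ₀ ^ 2 / τ ^ 2 + 1) * (1 - ρ₂))
    (hA2 : ∀ τ, A2 τ =
      (τ ^ 2 / (2 * Φ₀) - 1 / (2 * Φ₁ τ)) * (z ^ 2 - μ₀ ^ 2 / Φ₀) / 2 +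
        (μ₀ * τ / (2 * Φ₀) - μ₁ τ / (2 * Φ₁ τ)) ^ 2) :
    Tendsto (fun τ => Real.sqrt (max (A2 τ) 0) / τ) atTop
      (nhds (z / (2 * Real.sqrt Φ₀))) := by
  -- In the variable `s = 1/τ`, the rescaled function is continuous at `0`.
  let P : ℝ → ℝ := fun s => σε ^ 2 * (1 - ρ₁) * s ^ 2 + (σ₀ ^ 2 * s ^ 2 + 1) * (1 - ρ₂)
  let M : ℝ → ℝ := fun s => σε * q₁ * s + q₂ * Real.sqrt (σ₀ ^ 2 * s ^ 2 + 1)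
  let B : ℝ → ℝ := fun s => (1 / (2 * Φ₀) - s ^ 2 / (2 * P s)) * (z ^ 2 - μ₀ ^ 2 / Φ₀) / 2 +
    (μ₀ / (2 * Φ₀) - s * M s / (2 * P s)) ^ 2
  have hρ : 1 - ρ₂ ≠ 0 := (sub_pos.2 hρ₂.2).ne'
  have hP : 2 * P 0 ≠ 0 := by simpa [P] using hρ
  have hPc : ContinuousAt P 0 := by fun_prop
  have hMc : ContinuousAt M 0 := by fun_prop
  have hBc : ContinuousAt B 0 := by fun_prop (disch := assumption)
  have hB0 : B 0 = (z / (2 * Real.sqrt Φ₀)) ^ 2 := by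
    rw [div_pow, mul_pow, Real.sq_sqrt hΦ₀.le]
    simp only [B]
    field_simp
    ring
  have hlim : Tendsto (fun τ : ℝ => Real.sqrt (max (B τ⁻¹) 0)) atTop
      (nhds (z / (2 * Real.sqrt Φ₀))) := by
    have h := (hBc.tendsto.comp tendsto_inv_atTop_zero).max (tendsto_const_nhds (x := (0 : ℝ)))
    rw [hB0, max_eq_left (sq_nonneg _)] at h
    simpa only [Function.comp_apply, Real.sqrt_sq (show 0 ≤ z / (2 * Real.sqrt Φ₀) by positivity)] using h.sqrt
  refine hlim.congr' ?_
  filter_upwards [eventually_gt_atTop 0] with τ hτ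
  have hPτ : P τ⁻¹ = Φ₁ τ := by
    simp only [P, hΦ₁, inv_pow, div_eq_mul_inv]
  have hMτ : M τ⁻¹ = μ₁ τ := by
    simp only [M, hμ₁, inv_pow, div_eq_mul_inv]
  have hBτ : B τ⁻¹ = A2 τ / τ ^ 2 := by
    simp only [B, hPτ, hMτ, hA2, div_eq_mul_inv]
    field_simp
  have hmax : max (A2 τ / τ ^ 2) 0 = max (A2 τ) 0 / τ ^ 2 := by
    simpa using max_div_div_right (sq_nonneg τ) (A2 τ) 0
  rw [hBτ, hmax, Real.sqrt_div' _ (sq_nonneg τ), Real.sqrt_sq hτ.le]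
end

section
/- Fix σ_ε ≥ 0, σ_0 ≥ 0, ρ_1 ∈ [0,1], ρ_2 ∈ [0,1), q_1, q_2 ∈ ℝ, with Φ_0 = σ_ε²(1−ρ_1) + σ_0²(1−ρ_2) > 0, μ_0 = σ_ε q_1 + σ_0 q_2, and z > 0. For τ > 0 define μ_1(τ) = σ_ε q_1/τ + q_2√(σ_0²/τ² + 1), Φ_1(τ) = σ_ε²(1−ρ_1)/τ² + (σ_0²/τ² + 1)(1−ρ_2), A(τ) = √(max((τ²/(2Φ_0) − 1/(2Φ_1(τ)))·(z² − μ_0²/Φ_0)/2 + (μ_0τ/(2Φ_0) − μ_1(τ)/(2Φ_1(τ)))², 0)), and, for τ large enough that τ²/(2Φ_0) − 1/(2Φ_1(τ)) > 0, K_1(τ) = (μ_0τ/(2Φ_0) − μ_1(τ)/(2Φ_1(τ)) + A(τ)) / (τ²/(2Φ_0) − 1/(2Φ_1(τ))) and K_2(τ) = (μ_0τ/(2Φ_0) − μ_1(τ)/(2Φ_1(τ)) − A(τ)) / (τ²/(2Φ_0) − 1/(2Φ_1(τ))). Then lim_{τ→∞} τ·K_1(τ) = μ_0 + z√Φ_0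 and lim_{τ→∞} τ·K_2(τ) = μ_0 − z√Φ_0. -/
open Filter

/-- If `c` converges, then `(M * τ - c τ) / τ → M`. -/
lemma tendsto_linear_sub_div {c : ℝ → ℝ} {l : ℝ} (M : ℝ) (hc : Tendsto c atTop (nhds l)) :
    Tendsto (fun τ => (M * τ - c τ) / τ) atTop (nhds M) := by
  have h : Tendsto (fun τ => M - c τ / τ) atTop (nhds (M - 0)) :=
    tendsto_const_nhds.sub (hc.div_atTop tendsto_id)
  rw [sub_zero] at h
  refine h.congr' ?_
  filter_upwards [eventually_gt_atTop 0] with τ hτ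
  field_simp

/-- If `c` converges, then `(M * τ ^ 2 - c τ) / τ ^ 2 → M`. -/
lemma tendsto_quadratic_sub_div {c : ℝ → ℝ} {l : ℝ} (M : ℝ) (hc : Tendsto c atTop (nhds l)) :
    Tendsto (fun τ => (M * τ ^ 2 - c τ) / τ ^ 2) atTop (nhds M) := by
  have h : Tendsto (fun τ => M - c τ / τ ^ 2) atTop (nhds (M - 0)) :=
    tendsto_const_nhds.sub (hc.div_atTop (tendsto_pow_atTop two_ne_zero))
  rw [sub_zero] at h
  refine h.congr' ?_
  filter_upwards [eventually_gt_atTop 0] with τ hτ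
  field_simp

/-- A function that equals `N / D` wherever `D` is positive inherits the limit of
`τ * (N τ / D τ)` from the leading coefficients of `N` and `D`. -/
lemma tendsto_mul_quotient_of_leading {N D K : ℝ → ℝ} {n d : ℝ} (hd : 0 < d)
    (hN : Tendsto (fun τ => N τ / τ) atTop (nhds n))
    (hD : Tendsto (fun τ => D τ / τ ^ 2) atTop (nhds d))
    (hK : ∀ τ, 0 < D τ → K τ = N τ / D τ) :
    Tendsto (fun τ => τ * K τ) atTop (nhds (n / d)) := by
  refine (hN.div hD hd.ne').congr' ?_
  filter_upwards [eventually_gt_atTop 0, hD.eventually_const_lt hd] with τ hτ hDτ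
  have hpos : 0 < D τ := (div_pos_iff_of_pos_right (by positivity)).1 hDτ
  rw [Pi.div_apply, hK τ hpos]
  field_simp

/-- Result 2, part 2: the Neyman–Pearson thresholds
`K₁(τ) = (μ₀τ/(2Φ₀) - μ₁(τ)/(2Φ₁(τ)) + A(τ)) / (τ²/(2Φ₀) - 1/(2Φ₁(τ)))` and
`K₂(τ) = (μ₀τ/(2Φ₀) - μ₁(τ)/(2Φ₁(τ)) - A(τ)) / (τ²/(2Φ₀) - 1/(2Φ₁(τ)))`, with
`A(τ) = √(max((τ²/(2Φ₀) - 1/(2Φ₁(τ)))·(z² - μ₀²/Φ₀)/2 + (μ₀τ/(2Φ₀) - μ₁(τ)/(2Φ₁(τ)))², 0))`,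
satisfy `τ·K₁(τ) → μ₀ + z√Φ₀` and `τ·K₂(τ) → μ₀ - z√Φ₀` as `τ → ∞`. -/
theorem NP_thresholds_asymptotics (σε σ₀ ρ₁ ρ₂ : ℝ) (hσε : 0 ≤ σε) (hσ₀ : 0 ≤ σ₀)
    (hρ₁ : ρ₁ ∈ Set.Icc (0 : ℝ) 1) (hρ₂ : ρ₂ ∈ Set.Ico (0 : ℝ) 1)
    (q₁ q₂ : ℝ) (Φ₀ μ₀ : ℝ)
    (hΦ₀def : Φ₀ = σε ^ 2 * (1 - ρ₁) + σ₀ ^ 2 * (1 - ρ₂)) (hΦ₀ : 0 < Φ₀)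
    (hμ₀ : μ₀ = σε * q₁ + σ₀ * q₂) (z : ℝ) (hz : 0 < z)
    (μ₁ Φ₁ A K₁ K₂ : ℝ → ℝ)
    (hμ₁ : ∀ τ, μ₁ τ = σε * q₁ / τ + q₂ * Real.sqrt (σ₀ ^ 2 / τ ^ 2 + 1))
    (hΦ₁ : ∀ τ, Φ₁ τ = σε ^ 2 * (1 - ρ₁) / τ ^ 2 + (σ₀ ^ 2 / τ ^ 2 + 1) * (1 - ρ₂))
    (hA : ∀ τ, A τ = Real.sqrt (max
      ((τ ^ 2 / (2 * Φ₀) - 1 / (2 * Φ₁ τ)) * (z ^ 2 - μ₀ ^ 2 / Φ₀) / 2 +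
        (μ₀ * τ / (2 * Φ₀) - μ₁ τ / (2 * Φ₁ τ)) ^ 2) 0))
    (hK₁ : ∀ τ, 0 < τ ^ 2 / (2 * Φ₀) - 1 / (2 * Φ₁ τ) →
      K₁ τ = (μ₀ * τ / (2 * Φ₀) - μ₁ τ / (2 * Φ₁ τ) + A τ) /
        (τ ^ 2 / (2 * Φ₀) - 1 / (2 * Φ₁ τ)))
    (hK₂ : ∀ τ, 0 < τ ^ 2 / (2 * Φ₀) - 1 / (2 * Φ₁ τ) →
      K₂ τ = (μ₀ * τ / (2 * Φ₀) - μ₁ τ / (2 * Φ₁ τ) - A τ) /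
        (τ ^ 2 / (2 * Φ₀) - 1 / (2 * Φ₁ τ))) :
    Tendsto (fun τ => τ * K₁ τ) atTop (nhds (μ₀ + z * Real.sqrt Φ₀)) ∧
      Tendsto (fun τ => τ * K₂ τ) atTop (nhds (μ₀ - z * Real.sqrt Φ₀)) := by
  have hinv : ∀ c : ℝ, Tendsto (fun τ : ℝ => c / τ ^ 2) atTop (nhds 0) := fun c =>
    tendsto_const_nhds.div_atTop (tendsto_pow_atTop two_ne_zero)
  have hΦ₁lim : Tendsto Φ₁ atTop (nhds (1 - ρ₂)) := by
    have h := (hinv (σε ^ 2 * (1 - ρ₁))).add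
      (((hinv (σ₀ ^ 2)).add_const 1).mul_const (1 - ρ₂))
    simp only [zero_add, one_mul] at h
    exact h.congr fun τ => (hΦ₁ τ).symm
  have hμ₁lim : Tendsto μ₁ atTop (nhds q₂) := by
    have h := (tendsto_const_nhds (x := σε * q₁)).div_atTop tendsto_id |>.add
      ((((hinv (σ₀ ^ 2)).add_const 1).sqrt).const_mul q₂)
    simp only [zero_add, Real.sqrt_one, mul_one] at h
    exact h.congr fun τ => (hμ₁ τ).symm
  have h2 : 2 * (1 - ρ₂) ≠ 0 := by linarith [hρ₂.2]
  have hD : Tendsto (fun τ => (τ ^ 2 / (2 * Φ₀) - 1 / (2 * Φ₁ τ)) / τ ^ 2) atTop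
      (nhds (1 / (2 * Φ₀))) := by
    refine (tendsto_quadratic_sub_div (1 / (2 * Φ₀))
      ((tendsto_const_nhds (x := (1 : ℝ))).div (hΦ₁lim.const_mul 2) h2)).congr fun τ => ?_
    rw [Pi.div_apply, one_div_mul_eq_div]
  have hN : Tendsto (fun τ => (μ₀ * τ / (2 * Φ₀) - μ₁ τ / (2 * Φ₁ τ)) / τ) atTop
      (nhds (μ₀ / (2 * Φ₀))) := by
    refine (tendsto_linear_sub_div (μ₀ / (2 * Φ₀))
      (hμ₁lim.div (hΦ₁lim.const_mul 2) h2)).congr fun τ => ?_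
    rw [Pi.div_apply, div_mul_eq_mul_div]
  have hs : 0 < √Φ₀ := Real.sqrt_pos.2 hΦ₀
  have hsq : √Φ₀ ^ 2 = Φ₀ := Real.sq_sqrt hΦ₀.le
  have hAlim : Tendsto (fun τ => A τ / τ) atTop (nhds (z / (2 * √Φ₀))) := by
    have h := (((hD.mul_const (z ^ 2 - μ₀ ^ 2 / Φ₀)).div_const 2).add (hN.pow 2)).max
      (tendsto_const_nhds (x := (0 : ℝ))) |>.sqrt
    have hval : 1 / (2 * Φ₀) * (z ^ 2 - μ₀ ^ 2 / Φ₀) / 2 + (μ₀ / (2 * Φ₀)) ^ 2 =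
        (z / (2 * √Φ₀)) ^ 2 := by
      rw [div_pow z, mul_pow, hsq]
      field_simp
      ring
    rw [hval, max_eq_left (by positivity), Real.sqrt_sq (by positivity)] at h
    refine h.congr' ?_
    filter_upwards [eventually_gt_atTop 0] with τ hτ
    have hdiv (x : ℝ) : √(max x 0) / τ = √(max (x / τ ^ 2) 0) := by
      rw [← zero_div (τ ^ 2), max_div_div_right (by positivity), zero_div,
        Real.sqrt_div' _ (by positivity), Real.sqrt_sq hτ.le]
    rw [hA τ, hdiv]
    congr 2
    ring
  constructor
  · have h := tendsto_mul_quotient_of_leading (by positivity)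
      ((hN.add hAlim).congr fun τ => (add_div _ _ _).symm) hD hK₁
    convert h using 2
    field_simp
    linear_combination z * hsq
  · have h := tendsto_mul_quotient_of_leading (by positivity)
      ((hN.sub hAlim).congr fun τ => (sub_div _ _ _).symm) hD hK₂
    convert h using 2
    field_simp
    linear_combination -z * hsq
end
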